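/- arXiv:2403.04266 — 5 statements merged into one kernel-verified Lean document; each statement's English description precedes it below -/
import Mathlib

section
/- Let (R1, M1) and (R2, M2) be finite local commutative rings with unity whose maximal ideals M1 and M2 are principal, and let R = R1 × R2. Then two distinct non-unit elements x = (x1, x2) and y = (y1, y2) of R are NOT adjacent in the upper ideal relation graph Γ_U(R) if and only if one of x, y lies in M1 × (R2 \ M2) and the other lies in (R1 \ M1) × M2. Equivalently, Γ_U(R) is isomorphic to K_{|M1×M2|} ∨ (K_{|M1×(R2\M2)|} ∪ K_{|(R1\M1)×M2|}). -/
/-- The upper ideal relation graph of a commutative ring `R` with unity: vertices are the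
non-unit elements of `R`, and distinct vertices `x, y` are adjacent iff there is a non-unit
`z` with `(x) ⊆ (z)` and `(y) ⊆ (z)`. -/
def upperIdealRelGraph (R : Type*) [CommRing R] : SimpleGraph {x : R // ¬ IsUnit x} where
  Adj x y := x ≠ y ∧ ∃ z : R, ¬ IsUnit z ∧
      Ideal.span {(x : R)} ≤ Ideal.span {z} ∧ Ideal.span {(y : R)} ≤ Ideal.span {z}
  symm := by
    refine ⟨?_⟩
    rintro x y ⟨hxy, z, hz, h1, h2⟩
    exact ⟨hxy.symm, z, hz, h2, h1⟩
  loopless := by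
    refine ⟨?_⟩
    rintro x ⟨h, -⟩
    exact h rfl

/-- The join of two graphs: their disjoint union together with all edges between the
two parts. -/
def SimpleGraph.join {α β : Type*} (G : SimpleGraph α) (H : SimpleGraph β) :
    SimpleGraph (α ⊕ β) where
  Adj x y := match x, y with
    | Sum.inl a, Sum.inl b => G.Adj a b
    | Sum.inr a, Sum.inr b => H.Adj a b
    | Sum.inl _, Sum.inr _ => True
    | Sum.inr _, Sum.inl _ => True
  symm := ⟨by rintro (a | a) (b | b) h <;> first | exact G.adj_symm h | exact H.adj_symm h | trivial⟩
  loopless := ⟨by rintro (a | a) h <;> exact SimpleGraph.irrefl _ h⟩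

theorem uir_nonunit {R1 R2 : Type*} [CommRing R1] [CommRing R2]
    [IsLocalRing R1] [IsLocalRing R2] (x : R1 × R2) :
    ¬ IsUnit x ↔ (x.1 ∈ IsLocalRing.maximalIdeal R1 ∨ x.2 ∈ IsLocalRing.maximalIdeal R2) := by
  rw [Prod.isUnit_iff]
  simp only [IsLocalRing.mem_maximalIdeal, mem_nonunits_iff]
  tauto

theorem uir_adj {R1 R2 : Type*} [CommRing R1] [CommRing R2]
    [IsLocalRing R1] [IsLocalRing R2]
    (h1 : (IsLocalRing.maximalIdeal R1).IsPrincipal)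
    (h2 : (IsLocalRing.maximalIdeal R2).IsPrincipal)
    (x y : {x : R1 × R2 // ¬ IsUnit x}) :
    (upperIdealRelGraph (R1 × R2)).Adj x y ↔ x ≠ y ∧
      ((x.1.1 ∈ IsLocalRing.maximalIdeal R1 ∧ y.1.1 ∈ IsLocalRing.maximalIdeal R1) ∨
       (x.1.2 ∈ IsLocalRing.maximalIdeal R2 ∧ y.1.2 ∈ IsLocalRing.maximalIdeal R2)) := by
  change (x ≠ y ∧ ∃ z : R1 × R2, ¬ IsUnit z ∧ _ ∧ _) ↔ _
  refine and_congr_right fun _ => ?_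
  simp only [Ideal.span_singleton_le_span_singleton]
  constructor
  · rintro ⟨z, hz, ⟨a, ha⟩, ⟨b, hb⟩⟩
    rw [ha, hb]
    rcases (uir_nonunit z).1 hz with h | h
    · exact Or.inl ⟨Ideal.mul_mem_right _ _ h, Ideal.mul_mem_right _ _ h⟩
    · exact Or.inr ⟨Ideal.mul_mem_right _ _ h, Ideal.mul_mem_right _ _ h⟩
  · obtain ⟨g1, hg1⟩ := h1
    obtain ⟨g2, hg2⟩ := h2
    rintro (⟨hx, hy⟩ | ⟨hx, hy⟩)
    · refine ⟨(g1, 1), (uir_nonunit _).2 (Or.inl ?_), ?_⟩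
      · rw [hg1]; exact Submodule.mem_span_singleton_self g1
      · rw [hg1] at hx hy
        obtain ⟨a, ha⟩ := Submodule.mem_span_singleton.1 hx
        obtain ⟨b, hb⟩ := Submodule.mem_span_singleton.1 hy
        exact ⟨⟨(a, x.1.2), Prod.ext (by simp [← ha, mul_comm]) (by simp)⟩,
          ⟨(b, y.1.2), Prod.ext (by simp [← hb, mul_comm]) (by simp)⟩⟩
    · refine ⟨(1, g2), (uir_nonunit _).2 (Or.inr ?_), ?_⟩
      · rw [hg2]; exact Submodule.mem_span_singleton_self g2
      · rw [hg2] at hx hy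
        obtain ⟨a, ha⟩ := Submodule.mem_span_singleton.1 hx
        obtain ⟨b, hb⟩ := Submodule.mem_span_singleton.1 hy
        exact ⟨⟨(x.1.1, a), Prod.ext (by simp) (by simp [← ha, mul_comm])⟩,
          ⟨(y.1.1, b), Prod.ext (by simp) (by simp [← hb, mul_comm])⟩⟩

theorem uir_card {R : Type*} [Fintype R] [CommRing R] (I : Ideal R) :
    Nat.card {x : R // x ∉ I} = Fintype.card R - Nat.card I := by
  classical
  have h := Fintype.card_subtype_compl (fun x : R => x ∈ I)
  rw [Nat.card_eq_fintype_card, h, Nat.card_eq_fintype_card]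

/-- The map from the three blocks to the non-units. -/
def uirMap (R1 R2 : Type*) [CommRing R1] [CommRing R2] [IsLocalRing R1] [IsLocalRing R2] :
    ({x : R1 // x ∈ IsLocalRing.maximalIdeal R1} × {x : R2 // x ∈ IsLocalRing.maximalIdeal R2}) ⊕
    (({x : R1 // x ∈ IsLocalRing.maximalIdeal R1} × {x : R2 // x ∉ IsLocalRing.maximalIdeal R2}) ⊕
     ({x : R1 // x ∉ IsLocalRing.maximalIdeal R1} × {x : R2 // x ∈ IsLocalRing.maximalIdeal R2})) →
    {x : R1 × R2 // ¬ IsUnit x}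
  | .inl a => ⟨(a.1.1, a.2.1), (uir_nonunit _).2 (Or.inl a.1.2)⟩
  | .inr (.inl a) => ⟨(a.1.1, a.2.1), (uir_nonunit _).2 (Or.inl a.1.2)⟩
  | .inr (.inr a) => ⟨(a.1.1, a.2.1), (uir_nonunit _).2 (Or.inr a.2.2)⟩

theorem uirMap_bij (R1 R2 : Type*) [CommRing R1] [CommRing R2]
    [IsLocalRing R1] [IsLocalRing R2] : Function.Bijective (uirMap R1 R2) := by
  constructor
  · rintro (⟨⟨a, ha⟩, ⟨b, hb⟩⟩ | ⟨⟨a, ha⟩, ⟨b, hb⟩⟩ | ⟨⟨a, ha⟩, ⟨b, hb⟩⟩)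
      (⟨⟨c, hc⟩, ⟨d, hd⟩⟩ | ⟨⟨c, hc⟩, ⟨d, hd⟩⟩ | ⟨⟨c, hc⟩, ⟨d, hd⟩⟩) h <;>
    · have h' := congrArg Subtype.val h
      obtain ⟨rfl, rfl⟩ : a = c ∧ b = d := Prod.mk.inj h'
      first | rfl | exact absurd hb hd | exact absurd hd hb | exact absurd ha hc | exact absurd hc ha
  · rintro ⟨⟨a, b⟩, h⟩
    by_cases ha : a ∈ IsLocalRing.maximalIdeal R1
    · by_cases hb : b ∈ IsLocalRing.maximalIdeal R2
      · exact ⟨.inl (⟨a, ha⟩, ⟨b, hb⟩), rfl⟩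
      · exact ⟨.inr (.inl (⟨a, ha⟩, ⟨b, hb⟩)), rfl⟩
    · have hb := ((uir_nonunit _).1 h).resolve_left ha
      exact ⟨.inr (.inr (⟨a, ha⟩, ⟨b, hb⟩)), rfl⟩

theorem upperIdealRelGraph_prod_local_principal (R1 R2 : Type*) [CommRing R1] [CommRing R2]
    [Fintype R1] [Fintype R2] [IsLocalRing R1] [IsLocalRing R2]
    (h1 : (IsLocalRing.maximalIdeal R1).IsPrincipal)
    (h2 : (IsLocalRing.maximalIdeal R2).IsPrincipal) :
    (∀ x y : {x : R1 × R2 // ¬ IsUnit x}, x ≠ y →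
      (¬ (upperIdealRelGraph (R1 × R2)).Adj x y ↔
        ((x.1.1 ∈ IsLocalRing.maximalIdeal R1 ∧ x.1.2 ∉ IsLocalRing.maximalIdeal R2 ∧
            y.1.1 ∉ IsLocalRing.maximalIdeal R1 ∧ y.1.2 ∈ IsLocalRing.maximalIdeal R2) ∨
          (y.1.1 ∈ IsLocalRing.maximalIdeal R1 ∧ y.1.2 ∉ IsLocalRing.maximalIdeal R2 ∧
            x.1.1 ∉ IsLocalRing.maximalIdeal R1 ∧ x.1.2 ∈ IsLocalRing.maximalIdeal R2)))) ∧
    Nonempty ((upperIdealRelGraph (R1 × R2)) ≃g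
      SimpleGraph.join
        (⊤ : SimpleGraph (Fin
          (Nat.card (IsLocalRing.maximalIdeal R1) * Nat.card (IsLocalRing.maximalIdeal R2))))
        ((⊤ : SimpleGraph (Fin (Nat.card (IsLocalRing.maximalIdeal R1) *
            (Fintype.card R2 - Nat.card (IsLocalRing.maximalIdeal R2))))) ⊕g
          (⊤ : SimpleGraph (Fin ((Fintype.card R1 - Nat.card (IsLocalRing.maximalIdeal R1)) *
            Nat.card (IsLocalRing.maximalIdeal R2)))))) := by
  constructor
  · intro x y hxy
    rw [uir_adj h1 h2]
    have hx := (uir_nonunit _).1 x.2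
    have hy := (uir_nonunit _).1 y.2
    tauto
  · classical
    have e1 := Finite.equivFinOfCardEq (α := {x : R1 // x ∈ IsLocalRing.maximalIdeal R1} ×
      {x : R2 // x ∈ IsLocalRing.maximalIdeal R2}) (Nat.card_prod _ _)
    have e2 := Finite.equivFinOfCardEq (α := {x : R1 // x ∈ IsLocalRing.maximalIdeal R1} ×
      {x : R2 // x ∉ IsLocalRing.maximalIdeal R2}) ((Nat.card_prod _ _).trans
        (congrArg _ (uir_card (IsLocalRing.maximalIdeal R2))))
    have e3 := Finite.equivFinOfCardEq (α := {x : R1 // x ∉ IsLocalRing.maximalIdeal R1} ×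
      {x : R2 // x ∈ IsLocalRing.maximalIdeal R2}) ((Nat.card_prod _ _).trans
        (congrArg (· * _) (uir_card (IsLocalRing.maximalIdeal R1))))
    let e := Equiv.ofBijective _ (uirMap_bij R1 R2)
    let f := Equiv.sumCongr e1 (Equiv.sumCongr e2 e3)
    refine ⟨RelIso.symm ⟨f.symm.trans e, ?_⟩⟩
    intro u v
    obtain ⟨u, rfl⟩ := f.surjective u
    obtain ⟨v, rfl⟩ := f.surjective v
    rw [uir_adj h1 h2]
    simp only [Equiv.trans_apply, Equiv.symm_apply_apply, ne_eq, e.injective.eq_iff]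
    rcases u with ⟨⟨a, ha⟩, ⟨b, hb⟩⟩ | ⟨⟨a, ha⟩, ⟨b, hb⟩⟩ | ⟨⟨a, ha⟩, ⟨b, hb⟩⟩ <;>
    rcases v with ⟨⟨c, hc⟩, ⟨d, hd⟩⟩ | ⟨⟨c, hc⟩, ⟨d, hd⟩⟩ | ⟨⟨c, hc⟩, ⟨d, hd⟩⟩ <;>
    simp only [e, f, Equiv.ofBijective_apply, uirMap, SimpleGraph.join, Equiv.sumCongr_apply,
      Sum.map_inl, Sum.map_inr, SimpleGraph.sum, SimpleGraph.top_adj] <;>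
    simp [ha, hb, hc, hd, -IsLocalRing.mem_maximalIdeal]
end

section
/- Let R ≅ R1 × R2 × ⋯ × Rn be a product of n ≥ 4 nontrivial finite local commutative rings with unity. Then the upper ideal relation graph Γ_U(R) contains a clique of size 8, i.e., there exist eight distinct non-unit elements of R that are pairwise adjacent in Γ_U(R). -/
theorem upperIdealRelGraph_clique_8 {n : ℕ} (hn : 4 ≤ n) (Rs : Fin n → Type*)
    [∀ i, CommRing (Rs i)] [∀ i, Fintype (Rs i)] [∀ i, IsLocalRing (Rs i)] :
    ∃ s : Finset {x : ∀ i, Rs i // ¬ IsUnit x},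
      (upperIdealRelGraph (∀ i, Rs i)).IsNClique 8 s := by
  classical
  have nu : ∀ x : (∀ i, Rs i), x ⟨3, by omega⟩ = 0 → ¬ IsUnit x := by
    intro x hx hu
    have h := (Pi.isUnit_iff.mp hu) ⟨3, by omega⟩
    rw [hx] at h
    exact not_isUnit_zero h
  let g : (Fin 3 → Bool) → (∀ i, Rs i) := fun b i =>
    if h : i.val < 3 then (if b ⟨i.val, h⟩ = true then 1 else 0) else 0
  have hg : ∀ b, g b ⟨3, by omega⟩ = 0 := by
    intro b
    simp [g]
  let f : (Fin 3 → Bool) → {x : ∀ i, Rs i // ¬ IsUnit x} := fun b => ⟨g b, nu _ (hg b)⟩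
  have hf : Function.Injective f := by
    intro b c hbc
    have h1 : g b = g c := congrArg Subtype.val hbc
    funext j
    have h2 := congrFun h1 ⟨j.val, by omega⟩
    simp only [g, j.isLt, dif_pos, Fin.eta] at h2
    cases hb : b j <;> cases hc : c j <;> simp [hb, hc] at h2 ⊢
  let z : ∀ i, Rs i := fun i => if i.val = 3 then 0 else 1
  have hz : ¬ IsUnit z := nu z (by simp [z])
  have hle : ∀ b, Ideal.span {g b} ≤ Ideal.span {z} := by
    intro b
    rw [Ideal.span_singleton_le_span_singleton]
    refine ⟨g b, ?_⟩
    funext i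
    by_cases h : i.val = 3 <;> simp [g, z, h]
  refine ⟨Finset.univ.map ⟨f, hf⟩, ?_, ?_⟩
  · intro x hx y hy hxy
    simp only [Finset.coe_map, Set.mem_image, Function.Embedding.coeFn_mk] at hx hy
    obtain ⟨b, -, rfl⟩ := hx
    obtain ⟨c, -, rfl⟩ := hy
    exact ⟨hxy, z, hz, hle b, hle c⟩
  · simp
end

section
/- Let R1 and R2 be finite local commutative rings with unity, each of cardinality at least 3, and let R = R1 × R2. Then the upper ideal relation graph Γ_U(R) contains an induced 2K2: for any two distinct units a1, a2 of R1 and two distinct units b1, b2 of R2, the vertices (a1,0), (a2,0), (0,b1), (0,b2) satisfy: (a1,0)~(a2,0) and (0,b1)~(0,b2) are edges, and no other pair among these four vertices is adjacent. -/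
theorem aux_prod_not_adj {R1 R2 : Type*} [CommRing R1] [CommRing R2]
    (a : R1) (b : R2) (ha : IsUnit a) (hb : IsUnit b)
    (p : ¬ IsUnit ((a, 0) : R1 × R2)) (q : ¬ IsUnit ((0, b) : R1 × R2)) :
    ¬ (upperIdealRelGraph (R1 × R2)).Adj ⟨(a, 0), p⟩ ⟨(0, b), q⟩ := by
  rintro ⟨-, z, hz, h1, h2⟩
  rw [Ideal.span_singleton_le_span_singleton] at h1 h2
  apply hz
  rw [Prod.isUnit_iff]
  exact ⟨isUnit_of_dvd_unit (map_dvd (RingHom.fst R1 R2) h1) ha,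
    isUnit_of_dvd_unit (map_dvd (RingHom.snd R1 R2) h2) hb⟩

theorem upperIdealRelGraph_prod_induced2K2 (R1 R2 : Type*) [CommRing R1] [CommRing R2]
    [Fintype R1] [Fintype R2] [IsLocalRing R1] [IsLocalRing R2]
    (hcard1 : 3 ≤ Fintype.card R1) (hcard2 : 3 ≤ Fintype.card R2)
    (a1 a2 : R1) (b1 b2 : R2) (ha1 : IsUnit a1) (ha2 : IsUnit a2) (ha : a1 ≠ a2)
    (hb1 : IsUnit b1) (hb2 : IsUnit b2) (hb : b1 ≠ b2) :
    ∃ (p1 : ¬ IsUnit ((a1, 0) : R1 × R2)) (p2 : ¬ IsUnit ((a2, 0) : R1 × R2))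
      (q1 : ¬ IsUnit ((0, b1) : R1 × R2)) (q2 : ¬ IsUnit ((0, b2) : R1 × R2)),
      ((a1, 0) : R1 × R2) ≠ (a2, 0) ∧ ((a1, 0) : R1 × R2) ≠ (0, b1) ∧
      ((a1, 0) : R1 × R2) ≠ (0, b2) ∧ ((a2, 0) : R1 × R2) ≠ (0, b1) ∧
      ((a2, 0) : R1 × R2) ≠ (0, b2) ∧ ((0, b1) : R1 × R2) ≠ (0, b2) ∧
      (upperIdealRelGraph (R1 × R2)).Adj ⟨(a1, 0), p1⟩ ⟨(a2, 0), p2⟩ ∧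
      (upperIdealRelGraph (R1 × R2)).Adj ⟨(0, b1), q1⟩ ⟨(0, b2), q2⟩ ∧
      ¬ (upperIdealRelGraph (R1 × R2)).Adj ⟨(a1, 0), p1⟩ ⟨(0, b1), q1⟩ ∧
      ¬ (upperIdealRelGraph (R1 × R2)).Adj ⟨(a1, 0), p1⟩ ⟨(0, b2), q2⟩ ∧
      ¬ (upperIdealRelGraph (R1 × R2)).Adj ⟨(a2, 0), p2⟩ ⟨(0, b1), q1⟩ ∧
      ¬ (upperIdealRelGraph (R1 × R2)).Adj ⟨(a2, 0), p2⟩ ⟨(0, b2), q2⟩ := by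
  have p : ∀ a : R1, ¬ IsUnit ((a, 0) : R1 × R2) := fun a => by simp [Prod.isUnit_iff]
  have q : ∀ b : R2, ¬ IsUnit ((0, b) : R1 × R2) := fun b => by simp [Prod.isUnit_iff]
  have ha1' := ha1.ne_zero
  have ha2' := ha2.ne_zero
  refine ⟨p a1, p a2, q b1, q b2, by simp [ha], by simp [ha1'], by simp [ha1'],
    by simp [ha2'], by simp [ha2'], by simp [hb],
    ⟨by simp [ha], (1, 0), p 1, ?_, ?_⟩, ⟨by simp [hb], (0, 1), q 1, ?_, ?_⟩,
    aux_prod_not_adj _ _ ha1 hb1 _ _, aux_prod_not_adj _ _ ha1 hb2 _ _,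
    aux_prod_not_adj _ _ ha2 hb1 _ _, aux_prod_not_adj _ _ ha2 hb2 _ _⟩ <;>
  rw [Ideal.span_singleton_le_span_singleton]
  · exact ⟨(a1, 0), by simp⟩
  · exact ⟨(a2, 0), by simp⟩
  · exact ⟨(0, b1), by simp⟩
  · exact ⟨(0, b2), by simp⟩
end

section
/- Let R1 and R2 be commutative rings with unity, let u1 be a unit of R1, u2 a unit of R2, s a non-unit of R2, and t a non-unit of R1. Then (u1, s) and (t, u2) are distinct non-unit elements of R1 × R2 and they are NOT adjacent in the upper ideal relation graph Γ_U(R1 × R2). -/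
theorem upperIdealRelGraph_unit_nonunit_not_adj (R1 R2 : Type*) [CommRing R1] [CommRing R2]
    (u1 : R1) (u2 : R2) (s : R2) (t : R1) (hu1 : IsUnit u1) (hu2 : IsUnit u2)
    (hs : ¬ IsUnit s) (ht : ¬ IsUnit t) :
    ((u1, s) : R1 × R2) ≠ (t, u2) ∧
    ∃ (h1 : ¬ IsUnit ((u1, s) : R1 × R2)) (h2 : ¬ IsUnit ((t, u2) : R1 × R2)),
      ¬ (upperIdealRelGraph (R1 × R2)).Adj ⟨(u1, s), h1⟩ ⟨(t, u2), h2⟩ := by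
  refine ⟨?_, ?_, ?_, ?_⟩
  · intro h
    rw [Prod.mk.injEq] at h
    exact ht (h.1 ▸ hu1)
  · intro h
    exact hs (Prod.isUnit_iff.mp h).2
  · intro h
    exact ht (Prod.isUnit_iff.mp h).1
  · rintro ⟨-, z, hz, h1, h2⟩
    rw [Ideal.span_singleton_le_span_singleton] at h1 h2
    obtain ⟨a, ha⟩ := h1
    obtain ⟨b, hb⟩ := h2
    have e1 : u1 = z.1 * a.1 := congrArg Prod.fst ha
    have e2 : u2 = z.2 * b.2 := congrArg Prod.snd hb
    exact hz (Prod.isUnit_iff.mpr ⟨isUnit_of_dvd_unit ⟨_, e1⟩ hu1,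
      isUnit_of_dvd_unit ⟨_, e2⟩ hu2⟩)
end

section
/- Let R ≅ R1 × R2 × ⋯ × Rn be a product of n ≥ 3 nontrivial finite local commutative rings with unity. Then the upper ideal relation graph Γ_U(R) contains two distinct triangles sharing a common edge: the vertices a = (1,0,0,…,0), b = (0,1,0,…,0), c = (1,1,0,…,0), d = (0,0,1,0,…,0) are four distinct non-units such that {a,b,c} and {a,b,d} are both triangles (each pair within each triple is adjacent) sharing the edge a~b. In particular, Γ_U(R) is not a cactus graph. -/
/-- A cactus graph is a connected graph in which any two distinct simple cycles
(cycles being identified when they have the same edge set) have at most one vertex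
in common. -/
def SimpleGraph.IsCactus {V : Type*} (G : SimpleGraph V) : Prop :=
  G.Connected ∧ ∀ ⦃u v : V⦄ (c₁ : G.Walk u u) (c₂ : G.Walk v v),
    c₁.IsCycle → c₂.IsCycle → {e | e ∈ c₁.edges} ≠ {e | e ∈ c₂.edges} →
      ∀ x y : V, x ∈ c₁.support → x ∈ c₂.support → y ∈ c₁.support → y ∈ c₂.support → x = y

theorem pi_nonunit_of_zero {ι : Type*} {Rs : ι → Type*} [∀ i, CommRing (Rs i)]
    [∀ i, Nontrivial (Rs i)] (x : ∀ i, Rs i) (k : ι) (hx : x k = 0) : ¬ IsUnit x := by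
  intro h
  have := h.map (Pi.evalRingHom Rs k)
  simp [hx] at this

theorem upper_adj_of_zero {ι : Type*} [DecidableEq ι] {Rs : ι → Type*} [∀ i, CommRing (Rs i)]
    [∀ i, Nontrivial (Rs i)] (x y : {x : ∀ i, Rs i // ¬ IsUnit x}) (k : ι)
    (hx : x.1 k = 0) (hy : y.1 k = 0) (hxy : x.1 ≠ y.1) :
    (upperIdealRelGraph (∀ i, Rs i)).Adj x y := by
  have key : ∀ w : ∀ i, Rs i, w k = 0 →
      Ideal.span {w} ≤ Ideal.span {(fun i => if i = k then 0 else 1 : ∀ i, Rs i)} := by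
    intro w hw
    rw [Ideal.span_singleton_le_span_singleton]
    refine ⟨w, ?_⟩
    funext i
    by_cases h : i = k
    · subst h; simp [hw]
    · simp [h]
  exact ⟨fun h => hxy (congrArg Subtype.val h), _,
    pi_nonunit_of_zero _ k (by simp), key _ hx, key _ hy⟩

theorem not_cactus_of_triangles {V : Type*} (G : SimpleGraph V) (a b c d : V)
    (hcd : c ≠ d) (hab : G.Adj a b) (hac : G.Adj a c) (hbc : G.Adj b c)
    (had : G.Adj a d) (hbd : G.Adj b d) : ¬ G.IsCactus := by
  rintro ⟨-, h⟩
  have cyc : ∀ e (hae : G.Adj a e) (hbe : G.Adj b e),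
      (SimpleGraph.Walk.cons hab (.cons hbe (.cons hae.symm .nil))).IsCycle := by
    intro e hae hbe
    have := hab.ne; have := hab.ne'; have := hae.ne; have := hae.ne'
    have := hbe.ne; have := hbe.ne'
    rw [SimpleGraph.Walk.cons_isCycle_iff]
    simp_all [SimpleGraph.Walk.cons_isPath_iff]
  refine hab.ne (h _ _ (cyc c hac hbc) (cyc d had hbd) ?_ a b ?_ ?_ ?_ ?_)
  · intro he
    have h1 : s(b, c) ∈ {e | e ∈ (SimpleGraph.Walk.cons hab
      (.cons hbd (.cons had.symm .nil))).edges} := by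
      rw [← he]; simp
    have := hab.ne; have := hac.ne'; have := hbc.ne'
    simp at h1
    grind
  all_goals simp

theorem upperIdealRelGraph_two_triangles {n : ℕ} (hn : 3 ≤ n) (Rs : Fin n → Type*)
    [∀ i, CommRing (Rs i)] [∀ i, Fintype (Rs i)] [∀ i, IsLocalRing (Rs i)] :
    (∀ a b c d : ∀ i, Rs i,
      (a = fun i => if i = (⟨0, by omega⟩ : Fin n) then 1 else 0) →
      (b = fun i => if i = (⟨1, by omega⟩ : Fin n) then 1 else 0) →
      (c = fun i => if i = (⟨0, by omega⟩ : Fin n) ∨ i = (⟨1, by omega⟩ : Fin n)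
        then 1 else 0) →
      (d = fun i => if i = (⟨2, by omega⟩ : Fin n) then 1 else 0) →
      ∃ (ha : ¬ IsUnit a) (hb : ¬ IsUnit b) (hc : ¬ IsUnit c) (hd : ¬ IsUnit d),
        a ≠ b ∧ a ≠ c ∧ a ≠ d ∧ b ≠ c ∧ b ≠ d ∧ c ≠ d ∧
        (upperIdealRelGraph (∀ i, Rs i)).Adj ⟨a, ha⟩ ⟨b, hb⟩ ∧
        (upperIdealRelGraph (∀ i, Rs i)).Adj ⟨a, ha⟩ ⟨c, hc⟩ ∧
        (upperIdealRelGraph (∀ i, Rs i)).Adj ⟨b, hb⟩ ⟨c, hc⟩ ∧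
        (upperIdealRelGraph (∀ i, Rs i)).Adj ⟨a, ha⟩ ⟨d, hd⟩ ∧
        (upperIdealRelGraph (∀ i, Rs i)).Adj ⟨b, hb⟩ ⟨d, hd⟩) ∧
    ¬ (upperIdealRelGraph (∀ i, Rs i)).IsCactus := by
  have h01 : (⟨0, by omega⟩ : Fin n) ≠ ⟨1, by omega⟩ := by simp
  have h02 : (⟨0, by omega⟩ : Fin n) ≠ ⟨2, by omega⟩ := by simp
  have h12 : (⟨1, by omega⟩ : Fin n) ≠ ⟨2, by omega⟩ := by simp
  generalize (⟨0, by omega⟩ : Fin n) = i0 at *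
  generalize (⟨1, by omega⟩ : Fin n) = i1 at *
  generalize (⟨2, by omega⟩ : Fin n) = i2 at *
  refine (fun h => ⟨h, ?_⟩) ?_
  rotate_left
  · obtain ⟨ha, hb, hc, hd, -, -, -, -, -, hcd, h1, h2, h3, h4, h5⟩ := h _ _ _ _ rfl rfl rfl rfl
    exact not_cactus_of_triangles _ _ _ _ _ (fun h => hcd (congrArg Subtype.val h)) h1 h2 h3 h4 h5
  · intro a b c d ha hb hc hd
    have a0 : a i0 = 1 := by simp [ha]
    have a1 : a i1 = 0 := by simp [ha, h01.symm]
    have a2 : a i2 = 0 := by simp [ha, h02.symm]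
    have b0 : b i0 = 0 := by simp [hb, h01]
    have b1 : b i1 = 1 := by simp [hb]
    have b2 : b i2 = 0 := by simp [hb, h12.symm]
    have c0 : c i0 = 1 := by simp [hc]
    have c1 : c i1 = 1 := by simp [hc]
    have c2 : c i2 = 0 := by simp [hc, h02.symm, h12.symm]
    have d0 : d i0 = 0 := by simp [hd, h02]
    have d1 : d i1 = 0 := by simp [hd, h12]
    have ne : ∀ (x y : ∀ i, Rs i) (k : Fin n), x k = 1 → y k = 0 → x ≠ y := by
      rintro x y k hx hy rfl
      exact one_ne_zero (hx.symm.trans hy)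
    have ab := ne a b _ a0 b0
    have ac := (ne c a _ c1 a1).symm
    have ad := ne a d _ a0 d0
    have bc := (ne c b _ c0 b0).symm
    have bd := ne b d _ b1 d1
    have cd := ne c d _ c0 d0
    exact ⟨pi_nonunit_of_zero _ _ a2, pi_nonunit_of_zero _ _ b2, pi_nonunit_of_zero _ _ c2,
      pi_nonunit_of_zero _ _ d0, ab, ac, ad, bc, bd, cd,
      upper_adj_of_zero _ _ i2 a2 b2 ab, upper_adj_of_zero _ _ i2 a2 c2 ac,
      upper_adj_of_zero _ _ i2 b2 c2 bc, upper_adj_of_zero _ _ i1 a1 d1 ad,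
      upper_adj_of_zero _ _ i0 b0 d0 bd⟩
end
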